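/- Let P be an n×n row-stochastic matrix with stationary distribution π, let Φ be an n×K real matrix, let γ ∈ (0,1), and let r(s,s') be real rewards. Define the mean TD(0) direction ḡ(θ) = Σ_{s,s'} π_s P(s,s') (r(s,s') + γ φ(s')ᵀθ − φ(s)ᵀθ) φ(s), and suppose θ* ∈ ℝ^K satisfies ḡ(θ*) = 0. Then for every θ ∈ ℝ^K, (θ* − θ)ᵀ ḡ(θ) = (1−γ) ‖V_{θ*} − V_θ‖_D² + γ ‖V_{θ*} − V_θ‖_Dir², where V_θ = Φθ. -/

import Mathlib

open scoped BigOperators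
open Matrix

/-- The Dirichlet seminorm of `v` in terms of the weighted second moment and the one-step
correlation, for a stochastic matrix with stationary weights. -/
theorem half_sum_sq_sub_eq_of_stationary {ι : Type*} [Fintype ι] (P : Matrix ι ι ℝ) (π : ι → ℝ)
    (hProw : ∀ i, ∑ j, P i j = 1) (hstat : ∀ j, ∑ i, π i * P i j = π j) (v : ι → ℝ) :
    (1 / 2) * ∑ s, ∑ s', π s * P s s' * (v s' - v s) ^ 2 =
      ∑ s, π s * v s ^ 2 - ∑ s, ∑ s', π s * P s s' * (v s * v s') := by
  have hsrc : ∑ s, ∑ s', π s * P s s' * v s ^ 2 = ∑ s, π s * v s ^ 2 := by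
    simp_rw [← Finset.sum_mul, ← Finset.mul_sum, hProw, mul_one]
  have htgt : ∑ s, ∑ s', π s * P s s' * v s' ^ 2 = ∑ s, π s * v s ^ 2 := by
    rw [Finset.sum_comm]
    simp_rw [← Finset.sum_mul, hstat]
  have hexp : ∑ s, ∑ s', π s * P s s' * (v s' - v s) ^ 2 =
      ∑ s, ∑ s', π s * P s s' * v s' ^ 2 + ∑ s, ∑ s', π s * P s s' * v s ^ 2
        - 2 * ∑ s, ∑ s', π s * P s s' * (v s * v s') := by
    simp_rw [Finset.mul_sum, ← Finset.sum_add_distrib, ← Finset.sum_sub_distrib]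
    refine Finset.sum_congr rfl fun s _ => Finset.sum_congr rfl fun s' _ => ?_
    ring
  rw [hexp, hsrc, htgt]
  ring

/-- Pairing a feature-weighted double sum with `u` replaces the features by `Φ u`. -/
theorem dotProduct_sum_sum_mul_row {ι κ : Type*} [Fintype ι] [Fintype κ] (Φ : Matrix ι κ ℝ)
    (c : ι → ι → ℝ) (u : κ → ℝ) :
    (u ⬝ᵥ fun l => ∑ s, ∑ s', c s s' * Φ s l) = ∑ s, ∑ s', c s s' * Φ.mulVec u s := by
  simp_rw [← Finset.sum_mul]
  simp only [dotProduct, mulVec, Finset.mul_sum]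
  rw [Finset.sum_comm]
  refine Finset.sum_congr rfl fun s _ => Finset.sum_congr rfl fun l _ => ?_
  ring

/-- For the mean TD(0) direction `ḡ` with fixed point `θ*` (`ḡ(θ*) = 0`),
`(θ* − θ)ᵀ ḡ(θ) = (1−γ)‖V_{θ*} − V_θ‖_D² + γ‖V_{θ*} − V_θ‖_Dir²`, `V_θ = Φθ`. -/
theorem stmt_4 (n K : ℕ) (hn : 0 < n) (hK : 0 < K)
    (P : Matrix (Fin n) (Fin n) ℝ) (π : Fin n → ℝ)
    (hPnn : ∀ i j, 0 ≤ P i j) (hProw : ∀ i, ∑ j, P i j = 1)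
    (hπnn : ∀ i, 0 ≤ π i) (hπ1 : ∑ i, π i = 1)
    (hstat : ∀ j, ∑ i, π i * P i j = π j)
    (Φ : Matrix (Fin n) (Fin K) ℝ) (γ : ℝ) (hγ : 0 < γ ∧ γ < 1)
    (r : Fin n → Fin n → ℝ)
    (gbar : (Fin K → ℝ) → (Fin K → ℝ))
    (hgbar : ∀ θ l, gbar θ l =
      ∑ s, ∑ s', π s * P s s' *
        (r s s' + γ * Φ.mulVec θ s' - Φ.mulVec θ s) * Φ s l)
    (θstar : Fin K → ℝ) (hθstar : gbar θstar = 0)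
    (θ : Fin K → ℝ) :
    (θstar - θ) ⬝ᵥ gbar θ =
      (1 - γ) * (∑ s, π s * (Φ.mulVec θstar s - Φ.mulVec θ s)^2)
        + γ * ((1/2) * ∑ s, ∑ s', π s * P s s' *
            ((Φ.mulVec θstar s' - Φ.mulVec θ s') - (Φ.mulVec θstar s - Φ.mulVec θ s))^2) := by
  set v : Fin n → ℝ := fun s => Φ.mulVec θstar s - Φ.mulVec θ s with hv
  have hpair : ∀ w, (θstar - θ) ⬝ᵥ gbar w =
      ∑ s, ∑ s', π s * P s s' * (r s s' + γ * Φ.mulVec w s' - Φ.mulVec w s) * v s := by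
    intro w
    rw [funext (hgbar w), dotProduct_sum_sum_mul_row Φ
      (fun s s' => π s * P s s' * (r s s' + γ * Φ.mulVec w s' - Φ.mulVec w s))]
    simp only [hv, mulVec_sub, Pi.sub_apply]
  have hzero := hpair θstar
  rw [hθstar, dotProduct_zero] at hzero
  have hdiff : (θstar - θ) ⬝ᵥ gbar θ =
      ∑ s, ∑ s', π s * P s s' * v s ^ 2 - γ * ∑ s, ∑ s', π s * P s s' * (v s * v s') := by
    rw [← sub_zero ((θstar - θ) ⬝ᵥ gbar θ), hzero, hpair]
    simp_rw [Finset.mul_sum, ← Finset.sum_sub_distrib]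
    refine Finset.sum_congr rfl fun s _ => Finset.sum_congr rfl fun s' _ => ?_
    simp only [hv]
    ring
  have hsrc : ∑ s, ∑ s', π s * P s s' * v s ^ 2 = ∑ s, π s * v s ^ 2 := by
    simp_rw [← Finset.sum_mul, ← Finset.mul_sum, hProw, mul_one]
  have hdir := half_sum_sq_sub_eq_of_stationary P π hProw hstat v
  rw [hdiff, hsrc]
  change _ = (1 - γ) * (∑ s, π s * v s ^ 2)
    + γ * ((1 / 2) * ∑ s, ∑ s', π s * P s s' * (v s' - v s) ^ 2)
  rw [hdir]
  ring
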